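/- Let X be a Banach space, 1 ≤ p ≤ ∞ with conjugate p', and 0 < q < p'. Let ρ = (ρ_j)_{j≥1} be nondecreasing with ρ_1 > 1 and (ρ_j^{-1})_{j≥1} ∈ ℓ_q(ℕ). Set θ := 1 − q/p', κ_j := ρ_j^θ, q_θ := q/θ, r := −1 + 1/p + 1/q. Let (t_μ)_{μ∈F} ⊂ X with ‖(ρ^μ‖t_μ‖_X)_μ‖_{ℓ_p(F)} < ∞ and u(y) = Σ_μ t_μ y^μ absolutely convergent for all y ∈ Y; set C := C(κ,q_θ) · Σ_μ κ^μ ‖t_μ‖_X, where C(κ,q_θ) := β^{1/q_θ} exp((β/q_θ)‖(κ_j^{-1})‖_{ℓ_{q_θ}}^{q_θ}) and β := −ln(1 − κ_1^{−q_θ})κ_1^{q_θ}. Let ε > 0 and m ≥ 0 satisfy C‖(κ_j^{-1})_{j≥1}‖_{ℓ_{q_θ}}(m+1)^{−r} > ε, let J ≥ 1 be the smallest integer with Σ_{j≥J+1} ρ_j^{−q} ≤ (1/2) C^{−q_θ} (m+1)^{q_θ r} ε^{q_θ}, and set σ := (1/(2J))^{1/q_θ} C^{−1}(m+1)^r ε.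 Then there is a finite collection R of N hyperrectangles of the form Q = {y ∈ Y : |y_j − ȳ_j| ≤ λ_j for all j} with λ_j = 1 and ȳ_j = 0 for all j > J, whose union is Y, such that: (i) for each Q ∈ R there is a set Λ_Q ⊆ F with #Λ_Q = m+1 and coefficients (c_ν)_{ν∈Λ_Q} ⊂ X for which sup_{y∈Q} ‖u(y) − Σ_{ν∈Λ_Q} c_ν (y − ȳ)^ν‖_X ≤ ε; and (ii) N ≤ ∏_{j=1}^{J} (σ^{−1} |ln(1 − ρ_j^{−θ})| + 2). -/

import Mathlib

open scoped BigOperators ENNReal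

noncomputable section

/-- The set `F` of finitely supported multi-indices. -/
abbrev MIdx : Type := ℕ →₀ ℕ

/-- `ρ^ν := ∏_j ρ_j^{ν_j}` for a finitely supported multi-index `ν`. -/
def mpow (ρ : ℕ → ℝ) (ν : MIdx) : ℝ := ν.prod fun j k => ρ j ^ k

/-- The `ℓ_p(F)` norm (`p ∈ [1,∞]`, valued in `ℝ≥0∞`) of a family of nonnegative reals. -/
def lpF (p : ℝ≥0∞) (a : MIdx → ℝ) : ℝ≥0∞ :=
  if p = ∞ then ⨆ ν, ENNReal.ofReal (a ν)
  else (∑' ν, ENNReal.ofReal (a ν) ^ p.toReal) ^ (1 / p.toReal)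

section MultiIndex

lemma mpow_eq_prod (a : ℕ → ℝ) (ν : MIdx) : mpow a ν = ∏ j ∈ ν.support, a j ^ ν j := rfl

lemma mpow_zero (a : ℕ → ℝ) : mpow a 0 = 1 := Finsupp.prod_zero_index

lemma mpow_nonneg {a : ℕ → ℝ} (ha : ∀ j, 0 ≤ a j) (ν : MIdx) : 0 ≤ mpow a ν :=
  Finset.prod_nonneg fun j _ => pow_nonneg (ha j) _

lemma mpow_le_mpow {a b : ℕ → ℝ} (ha : ∀ j, 0 ≤ a j) (hab : ∀ j, a j ≤ b j) (ν : MIdx) :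
    mpow a ν ≤ mpow b ν :=
  Finset.prod_le_prod (fun j _ => pow_nonneg (ha j) _)
    fun j _ => pow_le_pow_left₀ (ha j) (hab j) _

lemma abs_mpow (a : ℕ → ℝ) (ν : MIdx) : |mpow a ν| = mpow (fun j => |a j|) ν := by
  simp only [mpow_eq_prod, Finset.abs_prod, abs_pow]

lemma mpow_mul (a b : ℕ → ℝ) (ν : MIdx) :
    mpow (fun j => a j * b j) ν = mpow a ν * mpow b ν := by
  simp only [mpow_eq_prod, mul_pow, Finset.prod_mul_distrib]

lemma mpow_rpow {a : ℕ → ℝ} (ha : ∀ j, 0 ≤ a j) (s : ℝ) (ν : MIdx) :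
    mpow (fun j => a j ^ s) ν = mpow a ν ^ s := by
  simp only [mpow_eq_prod]
  rw [← Real.finsetProd_rpow _ _ fun j _ => pow_nonneg (ha j) _]
  refine Finset.prod_congr rfl fun j _ => ?_
  rw [← Real.rpow_natCast, ← Real.rpow_mul (ha j), mul_comm, Real.rpow_mul (ha j),
    Real.rpow_natCast]

end MultiIndex

section TaylorShift

open MvPolynomial

/-- The polynomial `(X + c)^μ`, whose coefficients expand a monomial around the centre `c`. -/
def shiftPoly (c : ℕ → ℝ) (μ : MIdx) : MvPolynomial ℕ ℝ :=
  μ.prod fun j k => (X j + C (c j)) ^ k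

lemma eval_shiftPoly (c h : ℕ → ℝ) (μ : MIdx) :
    eval h (shiftPoly c μ) = mpow (fun j => h j + c j) μ := by
  simp [shiftPoly, Finsupp.prod, mpow_eq_prod]

lemma hasSum_coeff_mul_mpow (P : MvPolynomial ℕ ℝ) (h : ℕ → ℝ) :
    HasSum (fun ν : MIdx => coeff ν P * mpow h ν) (eval h P) := by
  rw [eval_eq]
  exact hasSum_sum_of_ne_finset_zero fun ν hν => by
    rw [notMem_support_iff.mp hν, zero_mul]

lemma abs_coeff_mul_le {P P' Q Q' : MvPolynomial ℕ ℝ}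
    (hP : ∀ ν, |coeff ν P| ≤ coeff ν P') (hQ : ∀ ν, |coeff ν Q| ≤ coeff ν Q') (ν : MIdx) :
    |coeff ν (P * Q)| ≤ coeff ν (P' * Q') := by
  rw [coeff_mul, coeff_mul]
  refine (Finset.abs_sum_le_sum_abs _ _).trans (Finset.sum_le_sum fun x _ => ?_)
  rw [abs_mul]
  exact mul_le_mul (hP _) (hQ _) (abs_nonneg _) ((abs_nonneg _).trans (hP _))

lemma abs_coeff_one_le (ν : MIdx) :
    |coeff ν (1 : MvPolynomial ℕ ℝ)| ≤ coeff ν (1 : MvPolynomial ℕ ℝ) := by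
  rw [coeff_one]; split_ifs <;> simp

lemma abs_coeff_shiftPoly_le (c : ℕ → ℝ) (μ ν : MIdx) :
    |coeff ν (shiftPoly c μ)| ≤ coeff ν (shiftPoly (fun j => |c j|) μ) := by
  have hlin : ∀ j (ν : MIdx), |coeff ν (X j + C (c j) : MvPolynomial ℕ ℝ)| ≤
      coeff ν (X j + C |c j| : MvPolynomial ℕ ℝ) := by
    intro j ν
    simp only [coeff_add, coeff_X, coeff_C]
    refine (abs_add_le _ _).trans (add_le_add ?_ ?_) <;> split_ifs <;> simp
  have hpow : ∀ j (k : ℕ) (ν : MIdx), |coeff ν ((X j + C (c j)) ^ k : MvPolynomial ℕ ℝ)| ≤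
      coeff ν ((X j + C |c j|) ^ k : MvPolynomial ℕ ℝ) := by
    intro j k
    induction k with
    | zero => simpa only [pow_zero] using abs_coeff_one_le
    | succ k ih => simpa only [pow_succ] using abs_coeff_mul_le ih (hlin j)
  unfold shiftPoly Finsupp.prod
  revert ν
  induction μ.support using Finset.induction_on with
  | empty => simpa only [Finset.prod_empty] using abs_coeff_one_le
  | insert j s hj ih =>
    simpa only [Finset.prod_insert hj] using abs_coeff_mul_le (hpow j (μ j)) ih

/-- Recentring a power series at `c`: if `κ_j = |c_j| + H_j`, the terms outside `Λ` contribute at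
most `δ · Σ_μ κ^μ ‖t_μ‖` on the cell `|y_j - c_j| ≤ λ_j` as soon as `λ^ν ≤ δ H^ν` off `Λ`. -/
lemma exists_coef_norm_sub_le
    {E : Type*} [NormedAddCommGroup E] [NormedSpace ℝ E] [CompleteSpace E]
    {κ c lam H : ℕ → ℝ} {t : MIdx → E} (hκ : ∀ j, κ j = H j + |c j|)
    (hlam : ∀ j, 0 ≤ lam j) (hlamH : ∀ j, lam j ≤ H j)
    (hsum : Summable fun μ : MIdx => mpow κ μ * ‖t μ‖) (Λ : Finset MIdx) {δ : ℝ}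
    (hδ : ∀ ν ∉ Λ, mpow lam ν ≤ δ * mpow H ν) (hδ0 : 0 ≤ δ) :
    ∃ coef : MIdx → E, ∀ y : ℕ → ℝ, (∀ j, |y j - c j| ≤ lam j) →
      ‖(∑' μ : MIdx, mpow y μ • t μ) -
        ∑ ν ∈ Λ, mpow (fun j => y j - c j) ν • coef ν‖ ≤ δ * ∑' μ : MIdx, mpow κ μ * ‖t μ‖ := by
  have hH : ∀ j, 0 ≤ H j := fun j => (hlam j).trans (hlamH j)
  set B : MIdx → MIdx → ℝ := fun μ ν => coeff ν (shiftPoly (fun j => |c j|) μ) with hB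
  have hAB : ∀ μ ν, |coeff ν (shiftPoly c μ)| ≤ B μ ν := fun μ ν => abs_coeff_shiftPoly_le c μ ν
  have hB0 : ∀ μ ν, 0 ≤ B μ ν := fun μ ν => (abs_nonneg _).trans (hAB μ ν)
  have hinner : ∀ μ, HasSum (fun ν => B μ ν * mpow H ν * ‖t μ‖) (mpow κ μ * ‖t μ‖) := by
    intro μ
    have := (hasSum_coeff_mul_mpow (shiftPoly (fun j => |c j|) μ) H).mul_right ‖t μ‖
    rw [eval_shiftPoly] at this
    rwa [funext hκ]
  set G : MIdx × MIdx → ℝ := fun x => B x.1 x.2 * mpow H x.2 * ‖t x.1‖ with hG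
  have hG0 : ∀ x, 0 ≤ G x := fun x =>
    mul_nonneg (mul_nonneg (hB0 _ _) (mpow_nonneg hH _)) (norm_nonneg _)
  have hGsum : Summable G := by
    refine (summable_prod_of_nonneg hG0).mpr ⟨fun μ => (hinner μ).summable, ?_⟩
    simpa only [hG, (hinner _).tsum_eq] using hsum
  have hGtsum : ∑' x, G x = ∑' μ : MIdx, mpow κ μ * ‖t μ‖ := by
    rw [hGsum.tsum_prod]
    simp only [hG, (hinner _).tsum_eq]
  refine ⟨fun ν => ∑' μ, coeff ν (shiftPoly c μ) • t μ, fun y hy => ?_⟩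
  set h : ℕ → ℝ := fun j => y j - c j with hh
  set f : MIdx × MIdx → E := fun x => (coeff x.2 (shiftPoly c x.1) * mpow h x.2) • t x.1 with hf
  have hmon : ∀ ν, |mpow h ν| ≤ mpow lam ν := fun ν => by
    rw [abs_mpow]; exact mpow_le_mpow (fun j => abs_nonneg _) hy ν
  have hfle : ∀ x, ‖f x‖ ≤ B x.1 x.2 * mpow lam x.2 * ‖t x.1‖ := fun x => by
    rw [hf, norm_smul, Real.norm_eq_abs, abs_mul]
    exact mul_le_mul_of_nonneg_right
      (mul_le_mul (hAB _ _) (hmon _) (abs_nonneg _) (hB0 _ _)) (norm_nonneg _)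
  have hfnorm : Summable fun x => ‖f x‖ := by
    refine Summable.of_nonneg_of_le (fun x => norm_nonneg _) (fun x => (hfle x).trans ?_) hGsum
    exact mul_le_mul_of_nonneg_right
      (mul_le_mul_of_nonneg_left (mpow_le_mpow hlam hlamH _) (hB0 _ _)) (norm_nonneg _)
  have hfsum : Summable f := hfnorm.of_norm
  have hu : ∑' x, f x = ∑' μ : MIdx, mpow y μ • t μ := by
    rw [hfsum.tsum_prod]
    refine tsum_congr fun μ => ?_
    have := ((hasSum_coeff_mul_mpow (shiftPoly c μ) h).smul_const (t μ)).tsum_eq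
    rw [eval_shiftPoly] at this
    simpa [hh] using this
  have hslice : ∀ ν, HasSum (fun μ => f (μ, ν))
      (mpow h ν • ∑' μ, coeff ν (shiftPoly c μ) • t μ) := by
    intro ν
    have hs : Summable fun μ => f (μ, ν) :=
      hfsum.comp_injective (Prod.mk_left_injective ν)
    convert hs.hasSum using 1
    rw [← tsum_const_smul'']
    refine tsum_congr fun μ => ?_
    rw [hf, smul_smul, mul_comm]
  have hΛ : HasSum (fun x : MIdx × MIdx => if x.2 ∈ Λ then f x else 0)
      (∑ ν ∈ Λ, mpow h ν • ∑' μ, coeff ν (shiftPoly c μ) • t μ) := by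
    have hs : Summable fun x : MIdx × MIdx => if x.2 ∈ Λ then f x else 0 := by
      refine Summable.of_norm_bounded hfnorm fun x => ?_
      split_ifs <;> simp
    convert hs.hasSum using 1
    have hswap := (Equiv.prodComm MIdx MIdx).summable_iff.mpr hs
    rw [← (Equiv.prodComm MIdx MIdx).tsum_eq]
    refine Eq.trans ?_ hswap.tsum_prod.symm
    rw [tsum_eq_sum (s := Λ)]
    · refine Finset.sum_congr rfl fun ν hν => ?_
      simp [hν, (hslice ν).tsum_eq]
    · intro ν hν
      simp [hν]
  rw [← hu, ← (hfsum.hasSum.sub hΛ).tsum_eq, ← hGtsum, ← tsum_mul_left]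
  refine tsum_of_norm_bounded (hGsum.mul_left δ).hasSum fun x => ?_
  split_ifs with hx
  · simpa using mul_nonneg hδ0 (hG0 x)
  · rw [sub_zero]
    refine (hfle x).trans ?_
    calc B x.1 x.2 * mpow lam x.2 * ‖t x.1‖ ≤ B x.1 x.2 * (δ * mpow H x.2) * ‖t x.1‖ :=
          mul_le_mul_of_nonneg_right
            (mul_le_mul_of_nonneg_left (hδ _ hx) (hB0 _ _)) (norm_nonneg _)
      _ = δ * G x := by rw [hG]; ring

end TaylorShift

section IndexSet

lemma inv_one_sub_le_exp {x x₀ : ℝ} (hx : 0 ≤ x) (hxx : x ≤ x₀) (h₀ : 0 < x₀) (h₁ : x₀ < 1) :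
    (1 - x)⁻¹ ≤ Real.exp (-Real.log (1 - x₀) * x₀⁻¹ * x) := by
  have hconc := strictConcaveOn_log_Ioi.concaveOn.2
    (show 1 - x₀ ∈ Set.Ioi (0 : ℝ) by simpa using h₁) (show (1 : ℝ) ∈ Set.Ioi 0 by simp)
    (show 0 ≤ x / x₀ by positivity)
    (show 0 ≤ 1 - x / x₀ by rw [sub_nonneg]; exact (div_le_one h₀).mpr hxx) (by ring)
  have hcomb : x / x₀ * (1 - x₀) + (1 - x / x₀) = 1 - x := by field_simp; ring
  simp only [smul_eq_mul, Real.log_one, mul_zero, add_zero, mul_one, hcomb] at hconc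
  rw [← Real.exp_log (show (0 : ℝ) < (1 - x)⁻¹ by rw [inv_pos]; linarith), Real.log_inv]
  refine Real.exp_le_exp.mpr ?_
  have : -Real.log (1 - x₀) * x₀⁻¹ * x = -(x / x₀ * Real.log (1 - x₀)) := by field_simp
  linarith

lemma sum_mpow_le_exp {v : ℕ → ℝ} {b : ℝ} (hv : ∀ j, 0 ≤ v j) (hv1 : ∀ j, v j < 1)
    (hexp : ∀ j, (1 - v j)⁻¹ ≤ Real.exp (b * v j)) (hb : 0 ≤ b) (hs : Summable v)
    (T : Finset MIdx) : ∑ ν ∈ T, mpow v ν ≤ Real.exp (b * ∑' j, v j) := by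
  classical
  set s : Finset ℕ := T.biUnion Finsupp.support with hsdef
  have hsub : ∀ ν ∈ T, ν.support ⊆ s := fun ν hν => Finset.subset_biUnion_of_mem _ hν
  set n : ℕ := T.sup fun ν => s.sup ν with hn
  set g : MIdx → s → ℕ := fun ν j => ν j with hg
  have hginj : Set.InjOn g T := by
    intro ν hν ν' hν' h
    ext j
    by_cases hj : j ∈ s
    · exact congrFun h ⟨j, hj⟩
    · rw [Finsupp.notMem_support_iff.mp fun hh => hj (hsub ν hν hh),
        Finsupp.notMem_support_iff.mp fun hh => hj (hsub ν' hν' hh)]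
  calc ∑ ν ∈ T, mpow v ν = ∑ ν ∈ T, ∏ j : s, v j ^ g ν j := by
        refine Finset.sum_congr rfl fun ν hν => ?_
        rw [mpow, Finsupp.prod_of_support_subset ν (hsub ν hν) _ fun _ _ => pow_zero _,
          ← Finset.prod_coe_sort]
    _ = ∑ k ∈ T.image g, ∏ j : s, v j ^ k j := by rw [Finset.sum_image hginj]
    _ ≤ ∑ k ∈ Fintype.piFinset fun _ : s => Finset.range (n + 1), ∏ j : s, v j ^ k j := by
        refine Finset.sum_le_sum_of_subset_of_nonneg ?_ fun k _ _ =>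
          Finset.prod_nonneg fun j _ => pow_nonneg (hv j) _
        intro k hk
        obtain ⟨ν, hν, rfl⟩ := Finset.mem_image.mp hk
        rw [Fintype.mem_piFinset]
        intro j
        rw [Finset.mem_range, Nat.lt_succ_iff]
        exact (Finset.le_sup (f := ν) j.2).trans (Finset.le_sup (f := fun ν : MIdx => s.sup ν) hν)
    _ = ∏ j : s, ∑ k ∈ Finset.range (n + 1), v j ^ k := by rw [Finset.prod_univ_sum]
    _ ≤ ∏ j : s, Real.exp (b * v j) := by
        refine Finset.prod_le_prod (fun j _ => Finset.sum_nonneg fun k _ => pow_nonneg (hv j) _)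
          fun j _ => le_trans ?_ (hexp j)
        rw [← tsum_geometric_of_lt_one (hv j) (hv1 j)]
        exact (summable_geometric_of_lt_one (hv j) (hv1 j)).sum_le_tsum _
          fun k _ => pow_nonneg (hv j) _
    _ = Real.exp (b * ∑ j ∈ s, v j) := by
        rw [Finset.prod_coe_sort s fun j => Real.exp (b * v j), ← Real.exp_sum, Finset.mul_sum]
    _ ≤ Real.exp (b * ∑' j, v j) :=
        Real.exp_le_exp.mpr (mul_le_mul_of_nonneg_left (hs.sum_le_tsum _ fun j _ => hv j) hb)

/-- Stechkin-type selection: some `Λ` with `m + 1` elements catches all large values of `a`,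
provided the sum of `a` over indices other than `i₀` is at most `A`. -/
lemma exists_finset_card_eq_mul_le {ι : Type*} [Infinite ι] (a : ι → ℝ) (i₀ : ι) (A : ℝ)
    (hA : ∀ T : Finset ι, i₀ ∉ T → ∑ i ∈ T, a i ≤ A) (m : ℕ) :
    ∃ Λ : Finset ι, Λ.card = m + 1 ∧ ∀ i ∉ Λ, ((m : ℝ) + 1) * a i ≤ A := by
  classical
  set L : Set ι := {i | i ≠ i₀ ∧ A < ((m : ℝ) + 1) * a i} with hL
  have hcard : ∀ T : Finset ι, (T : Set ι) ⊆ L → T.card ≠ m + 1 := by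
    intro T hT hTc
    have hne : T.Nonempty := Finset.card_pos.mp (by omega)
    have hlt : ∑ _i ∈ T, A < ∑ i ∈ T, ((m : ℝ) + 1) * a i :=
      Finset.sum_lt_sum_of_nonempty hne fun i hi => (hT hi).2
    rw [Finset.sum_const, hTc, nsmul_eq_mul, ← Finset.mul_sum] at hlt
    push_cast at hlt
    have := lt_of_mul_lt_mul_left hlt (by positivity)
    exact absurd (hA T fun h => (hT h).1 rfl) (not_le.mpr this)
  have hfin : L.Finite := by
    by_contra hinf
    obtain ⟨T, hT, hTc⟩ := Set.Infinite.exists_subset_card_eq hinf (m + 1)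
    exact hcard T hT hTc
  have hle : hfin.toFinset.card ≤ m := by
    by_contra! hlt
    obtain ⟨T, hT, hTc⟩ := Finset.exists_subset_card_eq (Nat.succ_le_of_lt hlt)
    exact hcard T (fun i hi => hfin.mem_toFinset.mp (hT hi)) hTc
  obtain ⟨Λ, hΛ, hΛc⟩ := Infinite.exists_superset_card_eq (insert i₀ hfin.toFinset) (m + 1)
    ((Finset.card_insert_le _ _).trans (Nat.succ_le_succ hle))
  refine ⟨Λ, hΛc, fun i hi => ?_⟩
  by_contra! hlt
  refine hi (hΛ (Finset.mem_insert_of_mem (hfin.mem_toFinset.mpr ⟨?_, hlt⟩)))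
  rintro rfl
  exact hi (hΛ (Finset.mem_insert_self _ _))

lemma exists_index_set {v : ℕ → ℝ} {x₀ b : ℝ} (hv : ∀ j, 0 ≤ v j) (hvx : ∀ j, v j ≤ x₀)
    (h₀ : 0 < x₀) (h₁ : x₀ < 1) (hb : b = -Real.log (1 - x₀) * x₀⁻¹) (hs : Summable v) (m : ℕ) :
    ∃ Λ : Finset MIdx, Λ.card = m + 1 ∧ ∀ ν ∉ Λ,
      ((m : ℝ) + 1) * mpow v ν ≤ b * (∑' j, v j) * Real.exp (b * ∑' j, v j) := by
  have hb0 : 0 ≤ b := by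
    rw [hb]
    exact mul_nonneg (neg_nonneg.mpr (Real.log_nonpos (by linarith) (by linarith)))
      (inv_nonneg.mpr h₀.le)
  refine exists_finset_card_eq_mul_le _ 0 _ (fun T hT => ?_) m
  have h := sum_mpow_le_exp hv (fun j => (hvx j).trans_lt h₁)
    (fun j => hb ▸ inv_one_sub_le_exp (hv j) (hvx j) h₀ h₁) hb0 hs (insert 0 T)
  rw [Finset.sum_insert hT, mpow_zero] at h
  set z := b * ∑' j, v j
  have hz := mul_le_mul_of_nonneg_right (Real.add_one_le_exp (-z)) (Real.exp_pos z).le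
  rw [← Real.exp_add, neg_add_cancel, Real.exp_zero] at hz
  linarith

end IndexSet

section Partition

lemma exists_mem_consecutive (p : ℕ → ℝ) {y : ℝ} (h₀ : p 0 ≤ y) {n : ℕ} (hn : 0 < n)
    (h₁ : y ≤ p n) : ∃ i < n, p i ≤ y ∧ y ≤ p (i + 1) := by
  induction n with
  | zero => omega
  | succ k ih =>
    rcases le_total (p k) y with h | h
    · exact ⟨k, by omega, h, h₁⟩
    · rcases Nat.eq_zero_or_pos k with rfl | hk
      · exact ⟨0, by omega, h₀, h₁⟩
      · obtain ⟨i, hi, hi'⟩ := ih hk h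
        exact ⟨i, by omega, hi'⟩

lemma one_sub_le_exp_mul (s : ℝ) (hs : 0 ≤ s) :
    1 - s ≤ Real.exp (-(2 * s)) * (1 + s) := by
  have hmono : MonotoneOn (fun x : ℝ => Real.exp (-(2 * x)) * (1 + x) - (1 - x)) (Set.Ici 0) := by
    refine monotoneOn_of_deriv_nonneg (convex_Ici 0) (by fun_prop) (by fun_prop) fun x _ => ?_
    have hd : HasDerivAt (fun x : ℝ => Real.exp (-(2 * x)) * (1 + x) - (1 - x))
        (Real.exp (-(2 * x)) * (-(2 * 1)) * (1 + x) + Real.exp (-(2 * x)) * 1 - (-1)) x :=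
      (((((hasDerivAt_id x).const_mul 2).neg).exp).mul ((hasDerivAt_id x).const_add 1)).sub
        ((hasDerivAt_id x).const_sub 1)
    rw [hd.deriv]
    have hz := mul_le_mul_of_nonneg_left (Real.add_one_le_exp (2 * x)) (Real.exp_pos (-(2 * x))).le
    rw [← Real.exp_add, neg_add_cancel, Real.exp_zero] at hz
    nlinarith
  have := hmono (Set.mem_Ici.mpr le_rfl) (Set.mem_Ici.mpr hs) hs
  simp at this
  linarith

/-- Geometrically graded partition of `[-1, 1]`: the half-width of every cell is at most `σ` times
the distance of its centre to `±k`. -/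
lemma exists_graded_partition {k σ : ℝ} (hk : 1 < k) (hσ : 0 < σ) :
    ∃ (n : ℕ) (c l : Bool × Fin n → ℝ),
      (2 * n : ℝ) ≤ σ⁻¹ * |Real.log (1 - k⁻¹)| + 2 ∧
      (∀ i, 0 < l i ∧ |c i| + l i ≤ 1 ∧ l i ≤ σ * (k - |c i|)) ∧
      ∀ y : ℝ, |y| ≤ 1 → ∃ i, |y - c i| ≤ l i := by
  have hk0 : 0 < k := by linarith
  have hk1 : 0 < 1 - k⁻¹ := sub_pos.mpr (inv_lt_one_of_one_lt₀ hk)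
  have hlogneg : Real.log (1 - k⁻¹) < 0 :=
    Real.log_neg hk1 (by linarith [inv_pos.mpr hk0])
  set L : ℝ := -Real.log (1 - k⁻¹) with hL
  have hL0 : 0 < L := neg_pos.mpr hlogneg
  set n : ℕ := ⌈L / (2 * σ)⌉₊ with hn
  have hn0 : 0 < n := Nat.ceil_pos.mpr (by positivity)
  have hnR : (0 : ℝ) < n := by exact_mod_cast hn0
  set g : ℝ := Real.exp (-(L / n)) with hg
  have hg0 : 0 < g := Real.exp_pos _
  have hg1 : g < 1 := Real.exp_lt_one_iff.mpr (neg_lt_zero.mpr (by positivity))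
  have hgσ : 1 - σ ≤ g * (1 + σ) := by
    refine (one_sub_le_exp_mul σ hσ.le).trans
      (mul_le_mul_of_nonneg_right (Real.exp_le_exp.mpr (neg_le_neg ?_)) (by linarith))
    rw [div_le_iff₀ hnR, ← div_le_iff₀' (by positivity)]
    exact Nat.le_ceil _
  have hgn : k * g ^ n = k - 1 := by
    rw [hg, ← Real.exp_nat_mul, mul_neg, mul_div_cancel₀ _ hnR.ne', hL, neg_neg,
      Real.exp_log hk1, mul_sub, mul_inv_cancel₀ hk0.ne', mul_one]
  have hz0 : ∀ i : ℕ, 0 < k * g ^ i := fun i => by positivity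
  have hzn : ∀ i : ℕ, i < n → k - 1 ≤ k * g ^ (i + 1) := fun i hi => by
    rw [← hgn]
    exact mul_le_mul_of_nonneg_left (pow_le_pow_of_le_one hg0.le hg1.le hi) hk0.le
  have hzk : ∀ i : ℕ, k * g ^ i ≤ k := fun i =>
    mul_le_of_le_one_right hk0.le (pow_le_one₀ hg0.le hg1.le)
  have hzs : ∀ i : ℕ, k * g ^ (i + 1) = g * (k * g ^ i) := fun i => by ring
  set a : ℕ → ℝ := fun i => k - (k * g ^ i + k * g ^ (i + 1)) / 2 with ha
  have ha0 : ∀ i, 0 ≤ a i := fun i => by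
    have := hzk i; have := hzk (i + 1); simp only [ha]; linarith
  refine ⟨n, fun x => if x.1 then a x.2 else -a x.2,
    fun x => (k * g ^ (x.2 : ℕ) - k * g ^ ((x.2 : ℕ) + 1)) / 2, ?_, ?_, ?_⟩
  · rw [abs_of_neg hlogneg, ← hL]
    have := (Nat.ceil_lt_add_one (show 0 ≤ L / (2 * σ) by positivity)).le
    rw [← hn] at this
    have h2 : σ⁻¹ * L = 2 * (L / (2 * σ)) := by field_simp
    linarith
  · rintro ⟨s, i⟩
    have habs : |if s then a i else -a i| = a i := by
      split_ifs
      · exact abs_of_nonneg (ha0 i)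
      · rw [abs_neg, abs_of_nonneg (ha0 i)]
    simp only [habs]
    have h1 := hz0 i
    have h2 := hzs i
    refine ⟨?_, ?_, ?_⟩
    · nlinarith
    · have := hzn i i.2
      simp only [ha]; linarith
    · simp only [ha]
      rw [h2]
      nlinarith
  · have hcover : ∀ y : ℝ, 0 ≤ y → y ≤ 1 → ∃ i : Fin n,
        |y - a i| ≤ (k * g ^ (i : ℕ) - k * g ^ ((i : ℕ) + 1)) / 2 := by
      intro y hy0 hy1
      obtain ⟨i, hi, h1, h2⟩ := exists_mem_consecutive (fun i => k - k * g ^ i)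
        (y := y) (by simpa using hy0) hn0 (by simp only [hgn]; linarith)
      refine ⟨⟨i, hi⟩, ?_⟩
      rw [abs_le]
      simp only [ha]
      constructor <;> linarith
    intro y hy
    rw [abs_le] at hy
    rcases le_total 0 y with h | h
    · obtain ⟨i, hi⟩ := hcover y h hy.2
      exact ⟨(true, i), by simpa using hi⟩
    · obtain ⟨i, hi⟩ := hcover (-y) (by linarith) (by linarith)
      refine ⟨(false, i), ?_⟩
      rw [abs_sub_comm] at hi
      simpa [add_comm] using hi

end Partition

section Cell

/-- Accuracy of a local Taylor polynomial with `m + 1` terms on one cell inside `[-1, 1]^ℕ`. -/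
lemma exists_taylor_on_cell
    {E : Type*} [NormedAddCommGroup E] [NormedSpace ℝ E] [CompleteSpace E]
    {κ c lam : ℕ → ℝ} {s : ℝ} (hs : 0 < s) (hκ1 : 1 < κ 0) (hκ0 : ∀ j, κ 0 ≤ κ j)
    (hκs : Summable fun j => ((κ j)⁻¹) ^ s)
    (hlam : ∀ j, 0 < lam j) (hcl : ∀ j, |c j| + lam j ≤ 1)
    {t : MIdx → E} (hsum : Summable fun μ : MIdx => mpow κ μ * ‖t μ‖)
    {b : ℝ} (hb : b = -Real.log (1 - κ 0 ^ (-s)) * κ 0 ^ s)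
    {C : ℝ} (hC : C = (b ^ (1 / s) * Real.exp (b / s * ∑' j, ((κ j)⁻¹) ^ s)) *
      ∑' μ : MIdx, mpow κ μ * ‖t μ‖) (hC0 : 0 < C) {ε : ℝ} (hε : 0 < ε) (m : ℕ)
    (hcell : ∑' j, (lam j / (κ j - |c j|)) ^ s ≤ (C⁻¹ * ((m : ℝ) + 1) ^ (1 / s) * ε) ^ s) :
    ∃ Λ : Finset MIdx, Λ.card = m + 1 ∧ ∃ coef : MIdx → E,
      ∀ y : ℕ → ℝ, (∀ j, |y j - c j| ≤ lam j) →
        ‖(∑' μ : MIdx, mpow y μ • t μ) -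
          ∑ ν ∈ Λ, mpow (fun j => y j - c j) ν • coef ν‖ ≤ ε := by
  have hκgt : ∀ j, 1 < κ j := fun j => hκ1.trans_le (hκ0 j)
  have hκpos : ∀ j, 0 < κ j := fun j => one_pos.trans (hκgt j)
  have hlam1 : ∀ j, lam j ≤ 1 := fun j => by linarith [hcl j, abs_nonneg (c j)]
  set H : ℕ → ℝ := fun j => κ j - |c j| with hH
  have hH0 : ∀ j, 0 < H j := fun j => by
    simp only [hH]; linarith [hcl j, hlam j, hκgt j]
  have hlamκ : ∀ j, lam j * κ j ≤ H j := fun j => by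
    simp only [hH]
    nlinarith [mul_nonneg (sub_nonneg.mpr (hκgt j).le) (sub_nonneg.mpr (hlam1 j)), hcl j]
  have hlamH : ∀ j, lam j ≤ H j := fun j =>
    (le_mul_of_one_le_right (hlam j).le (hκgt j).le).trans (hlamκ j)
  set w : ℕ → ℝ := fun j => lam j / H j with hw
  have hw0 : ∀ j, 0 ≤ w j := fun j => div_nonneg (hlam j).le (hH0 j).le
  have hwκ : ∀ j, w j ≤ (κ j)⁻¹ := fun j => by
    rw [hw, div_le_iff₀ (hH0 j), inv_mul_eq_div, le_div_iff₀ (hκpos j)]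
    exact hlamκ j
  set v : ℕ → ℝ := fun j => w j ^ s with hv
  have hv0 : ∀ j, 0 ≤ v j := fun j => Real.rpow_nonneg (hw0 j) _
  have hvκ : ∀ j, v j ≤ ((κ j)⁻¹) ^ s := fun j => Real.rpow_le_rpow (hw0 j) (hwκ j) hs.le
  have hvs : Summable v := Summable.of_nonneg_of_le hv0 hvκ hκs
  have hx : κ 0 ^ (-s) = ((κ 0)⁻¹) ^ s := by
    rw [Real.rpow_neg (hκpos 0).le, Real.inv_rpow (hκpos 0).le]
  have hx0 : 0 < κ 0 ^ (-s) := Real.rpow_pos_of_pos (hκpos 0) _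
  have hx1 : κ 0 ^ (-s) < 1 := Real.rpow_lt_one_of_one_lt_of_neg hκ1 (neg_lt_zero.mpr hs)
  have hvx : ∀ j, v j ≤ κ 0 ^ (-s) := fun j => by
    rw [hx]
    exact (hvκ j).trans (Real.rpow_le_rpow (inv_nonneg.mpr (hκpos j).le)
      (inv_anti₀ (hκpos 0) (hκ0 j)) hs.le)
  have hb' : b = -Real.log (1 - κ 0 ^ (-s)) * (κ 0 ^ (-s))⁻¹ := by
    rw [hb, Real.rpow_neg (hκpos 0).le, inv_inv]
  have hb0 : 0 ≤ b := by
    rw [hb']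
    exact mul_nonneg (neg_nonneg.mpr (Real.log_nonpos (by linarith) (by linarith)))
      (inv_nonneg.mpr hx0.le)
  obtain ⟨Λ, hΛc, hΛ⟩ := exists_index_set hv0 hvx hx0 hx1 hb' hvs m
  set S := ∑' j, v j with hS
  have hS0 : 0 ≤ S := tsum_nonneg hv0
  set M := ∑' μ : MIdx, mpow κ μ * ‖t μ‖ with hM
  have hM0 : 0 ≤ M := tsum_nonneg fun μ =>
    mul_nonneg (mpow_nonneg (fun j => (hκpos j).le) _) (norm_nonneg _)
  have hm : (0 : ℝ) < (m : ℝ) + 1 := by positivity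
  have hs' : 0 ≤ 1 / s := by positivity
  set δ := (b * S * Real.exp (b * S) / ((m : ℝ) + 1)) ^ (1 / s) with hδ
  have hδ0 : 0 ≤ δ := Real.rpow_nonneg (by positivity) _
  have hΛδ : ∀ ν ∉ Λ, mpow lam ν ≤ δ * mpow H ν := by
    intro ν hν
    have hwH : lam = fun j => w j * H j := funext fun j => (div_mul_cancel₀ _ (hH0 j).ne').symm
    have hwv : mpow w ν = mpow v ν ^ (1 / s) := by
      rw [hv, mpow_rpow hw0, ← Real.rpow_mul (mpow_nonneg hw0 ν), mul_one_div_cancel hs.ne',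
        Real.rpow_one]
    conv_lhs => rw [hwH, mpow_mul, hwv]
    refine mul_le_mul_of_nonneg_right (Real.rpow_le_rpow (mpow_nonneg hv0 ν) ?_ hs')
      (mpow_nonneg (fun j => (hH0 j).le) ν)
    rw [le_div_iff₀' hm]
    exact hΛ ν hν
  obtain ⟨coef, hcoef⟩ := exists_coef_norm_sub_le (c := c) (H := H) (t := t)
    (fun j => (sub_add_cancel (κ j) |c j|).symm) (fun j => (hlam j).le) hlamH hsum Λ hΛδ hδ0
  refine ⟨Λ, hΛc, coef, fun y hy => (hcoef y hy).trans ?_⟩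
  have hD0 : 0 ≤ C⁻¹ * ((m : ℝ) + 1) ^ (1 / s) * ε := by positivity
  have hSD : S ^ (1 / s) ≤ C⁻¹ * ((m : ℝ) + 1) ^ (1 / s) * ε := by
    refine (Real.rpow_le_rpow hS0 hcell hs').trans_eq ?_
    rw [← Real.rpow_mul hD0, mul_one_div_cancel hs.ne', Real.rpow_one]
  have hexp : Real.exp (b * S) ^ (1 / s) ≤ Real.exp (b / s * ∑' j, ((κ j)⁻¹) ^ s) := by
    rw [← Real.exp_mul, Real.exp_le_exp, mul_right_comm, mul_one_div]
    exact mul_le_mul_of_nonneg_left (hvs.tsum_le_tsum hvκ hκs) (by positivity)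
  rw [hδ, Real.div_rpow (by positivity) hm.le, Real.mul_rpow (by positivity) (Real.exp_pos _).le,
    Real.mul_rpow hb0 hS0]
  set R := ((m : ℝ) + 1) ^ (1 / s) with hR
  have hR0 : 0 < R := Real.rpow_pos_of_pos hm _
  set e := Real.exp (b / s * ∑' j, ((κ j)⁻¹) ^ s)
  have he : 0 < e := Real.exp_pos _
  have hbs : 0 ≤ b ^ (1 / s) := Real.rpow_nonneg hb0 _
  calc b ^ (1 / s) * S ^ (1 / s) * Real.exp (b * S) ^ (1 / s) / R * M
      ≤ b ^ (1 / s) * (C⁻¹ * R * ε) * e / R * M := by gcongr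
    _ = (b ^ (1 / s) * e * M) * C⁻¹ * ε := by field_simp
    _ = ε := by rw [← hC, mul_inv_cancel₀ hC0.ne', one_mul]

end Cell

/-- Bound on the library size for piecewise Taylor approximation of
`u ∈ B_{ρ,p}` (Theorem on the tensor-product partition of `Y = [-1,1]^ℕ`). Sequences are
`0`-indexed, so the paper's directions `j = 1, …, J` are indices `0, …, J-1`, `ρ_1 = ρ 0`,
`κ_min = κ 0 = (ρ 0)^θ`, the tail `Σ_{j ≥ J+1} ρ_j^{-q}` is `∑' i, (ρ (J + i))^{-q}`, and
hyperrectangles `Q = {y ∈ Y : |y_j - ȳ_j| ≤ λ_j}` have `ȳ_j = 0`, `λ_j = 1` for indices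
`≥ J`. Here `1/p' = 1 - 1/p.toReal`, and `0 < q < p'` is encoded by `0 < q` and `0 < r`. -/
theorem library_size_bound
    {X : Type*} [NormedAddCommGroup X] [NormedSpace ℝ X] [CompleteSpace X]
    (p : ℝ≥0∞) (hp : 1 ≤ p)
    (q : ℝ) (hq : 0 < q)
    (r : ℝ) (hrdef : r = -1 + 1 / p.toReal + 1 / q) (hr : 0 < r)
    (ρ : ℕ → ℝ) (hmono : Monotone ρ) (hρ1 : 1 < ρ 0)
    (hρq : Summable fun j => ((ρ j)⁻¹) ^ q)
    (θ : ℝ) (hθ : θ = 1 - q * (1 - 1 / p.toReal))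
    (κ : ℕ → ℝ) (hκ : ∀ j, κ j = ρ j ^ θ)
    (qθ : ℝ) (hqθ : qθ = q / θ)
    (t : MIdx → X)
    (hM : lpF p (fun μ => mpow ρ μ * ‖t μ‖) ≠ ∞)
    (habs : ∀ y : ℕ → ℝ, (∀ j, |y j| ≤ 1) →
      Summable fun μ : MIdx => ‖mpow y μ • t μ‖)
    (β : ℝ) (hβ : β = -Real.log (1 - κ 0 ^ (-qθ)) * κ 0 ^ qθ)
    (C : ℝ) (hC : C = (β ^ (1 / qθ) * Real.exp (β / qθ * ∑' j, ((κ j)⁻¹) ^ qθ)) *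
      ∑' μ : MIdx, mpow κ μ * ‖t μ‖)
    (ε : ℝ) (hε : 0 < ε) (m : ℕ)
    (hbig : ε < C * (∑' j, ((κ j)⁻¹) ^ qθ) ^ (1 / qθ) * ((m : ℝ) + 1) ^ (-r))
    (J : ℕ) (hJ1 : 1 ≤ J)
    (hJtail : (∑' i : ℕ, ((ρ (J + i))⁻¹) ^ q) ≤
      (1 / 2) * C ^ (-qθ) * ((m : ℝ) + 1) ^ (qθ * r) * ε ^ qθ)
    (hJmin : ∀ J' : ℕ, 1 ≤ J' →
      (∑' i : ℕ, ((ρ (J' + i))⁻¹) ^ q) ≤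
        (1 / 2) * C ^ (-qθ) * ((m : ℝ) + 1) ^ (qθ * r) * ε ^ qθ → J ≤ J')
    (σ : ℝ) (hσ : σ = (1 / (2 * (J : ℝ))) ^ (1 / qθ) * C⁻¹ * ((m : ℝ) + 1) ^ r * ε) :
    ∃ (N : ℕ) (c lam : Fin N → ℕ → ℝ),
      -- only the first J directions are subdivided
      (∀ i : Fin N, ∀ j : ℕ, J ≤ j → c i j = 0 ∧ lam i j = 1) ∧
      -- the hyperrectangles cover Y
      (∀ y : ℕ → ℝ, (∀ j, |y j| ≤ 1) → ∃ i : Fin N, ∀ j, |y j - c i j| ≤ lam i j) ∧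
      -- on each hyperrectangle, a local Taylor polynomial with m+1 terms is ε-accurate
      (∀ i : Fin N, ∃ Λ : Finset MIdx, Λ.card = m + 1 ∧ ∃ coef : MIdx → X,
        ∀ y : ℕ → ℝ, (∀ j, |y j| ≤ 1) → (∀ j, |y j - c i j| ≤ lam i j) →
          ‖(∑' μ : MIdx, mpow y μ • t μ) -
              ∑ ν ∈ Λ, mpow (fun j => y j - c i j) ν • coef ν‖ ≤ ε) ∧
      -- bound on the number of cells
      (N : ℝ) ≤ ∏ j ∈ Finset.range J, (σ⁻¹ * |Real.log (1 - ρ j ^ (-θ))| + 2) := by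
  have hθr : θ = q * r := by
    rw [hθ, hrdef]; field_simp; ring
  have hθ0 : 0 < θ := hθr ▸ mul_pos hq hr
  have hqr : 1 / qθ = r := by
    rw [hqθ, hθr]; field_simp
  have hqθ0 : 0 < qθ := hqθ ▸ div_pos hq hθ0
  have hρ0 : ∀ j, 1 < ρ j := fun j => hρ1.trans_le (hmono (Nat.zero_le j))
  have hρpos : ∀ j, 0 < ρ j := fun j => one_pos.trans (hρ0 j)
  have hκ1 : ∀ j, 1 < κ j := fun j => hκ j ▸ Real.one_lt_rpow (hρ0 j) hθ0
  have hκpos : ∀ j, 0 < κ j := fun j => one_pos.trans (hκ1 j)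
  have hκ0 : ∀ j, κ 0 ≤ κ j := fun j => by
    rw [hκ, hκ]; exact Real.rpow_le_rpow (hρpos 0).le (hmono (Nat.zero_le j)) hθ0.le
  have hκρ : ∀ j, ((κ j)⁻¹) ^ qθ = ((ρ j)⁻¹) ^ q := fun j => by
    rw [hκ, ← Real.inv_rpow (hρpos j).le, ← Real.rpow_mul (inv_nonneg.mpr (hρpos j).le), hqθ,
      mul_div_cancel₀ _ hθ0.ne']
  have hκs : Summable fun j => ((κ j)⁻¹) ^ qθ := by simpa only [hκρ] using hρq
  have hm : (0 : ℝ) < (m : ℝ) + 1 := by positivity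
  have hC0 : 0 < C := by
    have h1 : 0 ≤ (∑' j, ((κ j)⁻¹) ^ qθ) ^ (1 / qθ) := Real.rpow_nonneg
      (tsum_nonneg fun j => Real.rpow_nonneg (inv_nonneg.mpr (hκpos j).le) _) _
    have h2 : 0 ≤ ((m : ℝ) + 1) ^ (-r) := Real.rpow_nonneg hm.le _
    by_contra! hle
    exact absurd (hε.trans hbig) (not_lt.mpr
      (mul_nonpos_of_nonpos_of_nonneg (mul_nonpos_of_nonpos_of_nonneg hle h1) h2))
  have hsum : Summable fun μ : MIdx => mpow κ μ * ‖t μ‖ := by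
    by_contra hns
    rw [tsum_eq_zero_of_not_summable hns, mul_zero] at hC
    exact hC0.ne' hC
  set D : ℝ := C⁻¹ * ((m : ℝ) + 1) ^ r * ε with hD
  have hD0 : 0 < D := mul_pos (mul_pos (inv_pos.mpr hC0) (Real.rpow_pos_of_pos hm _)) hε
  have hJR : (0 : ℝ) < J := by exact_mod_cast hJ1
  have hσD : σ = (1 / (2 * (J : ℝ))) ^ (1 / qθ) * D := by rw [hσ, hD]; ring
  have hσ0 : 0 < σ := hσD ▸ mul_pos (Real.rpow_pos_of_pos (by positivity) _) hD0
  have hσpow : J * σ ^ qθ = 1 / 2 * D ^ qθ := by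
    rw [hσD, Real.mul_rpow (Real.rpow_nonneg (by positivity) _) hD0.le,
      ← Real.rpow_mul (by positivity), one_div_mul_cancel hqθ0.ne', Real.rpow_one]
    field_simp
  have htail : ∑' i : ℕ, ((ρ (J + i))⁻¹) ^ q ≤ 1 / 2 * D ^ qθ := by
    refine hJtail.trans_eq ?_
    rw [hD, Real.mul_rpow (by positivity) hε.le, Real.mul_rpow (by positivity) (by positivity),
      Real.inv_rpow hC0.le, Real.rpow_neg hC0.le, ← Real.rpow_mul hm.le, mul_comm r]
    ring
  choose n pc pl hn hcell hcover using fun j => exists_graded_partition (hκ1 j) hσ0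
  let I : Type := ∀ j : Fin J, Bool × Fin (n j)
  let cen : I → ℕ → ℝ := fun i j => if h : j < J then pc j (i ⟨j, h⟩) else 0
  let wid : I → ℕ → ℝ := fun i j => if h : j < J then pl j (i ⟨j, h⟩) else 1
  have hlow : ∀ (i : I) (j : ℕ), 0 < wid i j ∧ |cen i j| + wid i j ≤ 1 := by
    intro i j
    by_cases h : j < J
    · simp only [cen, wid, h, dif_pos]
      exact ⟨(hcell j _).1, (hcell j _).2.1⟩
    · simp [cen, wid, h]
  have hacc : ∀ i : I, ∑' j, (wid i j / (κ j - |cen i j|)) ^ qθ ≤ D ^ qθ := by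
    intro i
    have htl : ∀ j, J ≤ j → (wid i j / (κ j - |cen i j|)) ^ qθ = ((ρ j)⁻¹) ^ q := by
      intro j hj
      simp [cen, wid, not_lt.mpr hj, ← hκρ]
    have hshift : ∀ k, (wid i (k + J) / (κ (k + J) - |cen i (k + J)|)) ^ qθ =
        ((ρ (J + k))⁻¹) ^ q := fun k => by rw [htl _ (Nat.le_add_left _ _), add_comm]
    have hsumm : Summable fun j => (wid i j / (κ j - |cen i j|)) ^ qθ := by
      rw [← summable_nat_add_iff J]
      simp only [hshift, add_comm J]
      exact (summable_nat_add_iff J).mpr hρq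
    rw [← hsumm.sum_add_tsum_nat_add J]
    simp only [hshift]
    have hhead : ∑ j ∈ Finset.range J, (wid i j / (κ j - |cen i j|)) ^ qθ ≤ J * σ ^ qθ := by
      rw [← nsmul_eq_mul]
      refine (Finset.sum_le_card_nsmul _ _ (σ ^ qθ) fun j hj => ?_).trans_eq
        (by rw [Finset.card_range])
      have hj' := Finset.mem_range.mp hj
      have hpos : 0 < κ j - |cen i j| := by linarith [hlow i j, hκ1 j]
      refine Real.rpow_le_rpow (div_nonneg (hlow i j).1.le hpos.le) ?_ hqθ0.le
      rw [div_le_iff₀ hpos]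
      simp only [cen, wid, hj', dif_pos]
      exact (hcell j _).2.2
    linarith
  let e : Fin (Fintype.card I) ≃ I := (Fintype.equivFin I).symm
  refine ⟨Fintype.card I, fun i => cen (e i), fun i => wid (e i), ?_, ?_, ?_, ?_⟩
  · intro i j hj
    simp [cen, wid, not_lt.mpr hj]
  · intro y hy
    choose idx hidx using fun j => hcover j (y j) (hy j)
    refine ⟨e.symm fun j => idx j, fun j => ?_⟩
    simp only [Equiv.apply_symm_apply]
    by_cases h : j < J
    · simpa only [cen, wid, h, dif_pos] using hidx j
    · simpa [cen, wid, h] using hy j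
  · intro i
    obtain ⟨Λ, hΛ, coef, hcoef⟩ := exists_taylor_on_cell hqθ0 (hκ1 0) hκ0 hκs
      (fun j => (hlow (e i) j).1) (fun j => (hlow (e i) j).2) hsum hβ hC hC0 hε m
      (by rw [hqr]; exact hacc (e i))
    exact ⟨Λ, hΛ, coef, fun y _ => hcoef y⟩
  · have hcard : (Fintype.card I : ℝ) = ∏ j ∈ Finset.range J, (2 * n j : ℝ) := by
      rw [Finset.prod_range]
      simp [I]
    rw [hcard]
    refine Finset.prod_le_prod (fun j _ => by positivity) fun j _ => ?_
    rw [Real.rpow_neg (hρpos j).le, ← hκ]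
    exact hn j
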